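/- Let k be an algebraically closed field of characteristic p = 2 and let R = k⟦x,y,z⟧/(z^2 + x^3 + xy^3 + x^2 y z) (the rational double point of type E_7^1 in characteristic 2). Let τ := the Teichmüller lift of z/(xy) in 𝕎L, and let N_3 ⊆ 𝕎L be as in the context (with l = 3). Then: (i) F(τ) + V^2(τ) ∈ N_3; (ii) τ ∉ N_3; (iii) V(τ) ∉ N_3; (iv) V^2(τ) ∉ N_3. Equivalently, the class of the length-3 Teichmüller lift of z/(xy) in H^2_m(R, W_3O) satisfies (F + V^2)(class) = 0 and is not annihilated by V or V^2; this realizes the relations (F + V^2) ≡ V^3 ≡ 0 on the generator f_1^{(3)} of the Dieudonné module of E_7^1 in characteristic 2, which has length 3 (corresponding to Picloc^{loc,loc} ≅ L_{2,3}[V + F^2]). -/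

import Mathlib

set_option maxHeartbeats 1000000
set_option synthInstance.maxHeartbeats 400000

open MvPowerSeries

noncomputable section

variable (k : Type) [Field k]

/-- The formal power series ring `k⟦x,y,z⟧`. -/
abbrev PS := MvPowerSeries (Fin 3) k

/-- The hypersurface singularity `R = k⟦x,y,z⟧/(f)`. -/
abbrev Rq (f : PS k) : Type := PS k ⧸ Ideal.span {f}

/-- The image of `x` in `R`. -/
abbrev xR (f : PS k) : Rq k f := Ideal.Quotient.mk _ (X 0)
/-- The image of `y` in `R`. -/
abbrev yR (f : PS k) : Rq k f := Ideal.Quotient.mk _ (X 1)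
/-- The image of `z` in `R`. -/
abbrev zR (f : PS k) : Rq k f := Ideal.Quotient.mk _ (X 2)

/-- `L`: the localization of `R` inverting `x*y`. -/
abbrev Lloc (f : PS k) : Type := Localization.Away (xR k f * yR k f)

/-- The canonical map from the localization of `R` inverting `x` to `L`. -/
noncomputable def phiX (f : PS k) : Localization.Away (xR k f) →+* Lloc k f :=
  IsLocalization.Away.awayToAwayRight (S := Localization.Away (xR k f)) (P := Lloc k f)
    (xR k f) (yR k f)

/-- The canonical map from the localization of `R` inverting `y` to `L`. -/
noncomputable def phiY (f : PS k) : Localization.Away (yR k f) →+* Lloc k f :=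
  IsLocalization.Away.awayToAwayLeft (S := Localization.Away (yR k f)) (P := Lloc k f)
    (yR k f) (xR k f)

/-- `A ⊆ L`: the `R`-submodule generated by the images of `R_x` and `R_y` in `L`.
The quotient `L/A` is a Čech description of the local cohomology `H^2_m(R)`. -/
def Asub (f : PS k) : Submodule (Rq k f) (Lloc k f) :=
  Submodule.span (Rq k f) (Set.range (phiX k f) ∪ Set.range (phiY k f))

/-- The element `z/(x*y) ∈ L`. -/
noncomputable def zxy (f : PS k) : Lloc k f :=
  Localization.mk (zR k f) ⟨xR k f * yR k f, Submonoid.mem_powers _⟩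

/-- The element `f_j := z/(x*y^j) = z*x^(j-1)/(x*y)^j ∈ L` (for `j ≥ 1`). -/
noncomputable def fcls (f : PS k) (j : ℕ) : Lloc k f :=
  Localization.mk (zR k f * xR k f ^ (j - 1)) ⟨(xR k f * yR k f) ^ j, j, rfl⟩

/-- `N_l ⊆ 𝕎L`: the additive subgroup generated by the images of the Witt vectors of the
localizations of `R` inverting `x` and inverting `y`, together with the image of `V^l`.
The quotient `𝕎L/N_l` is a Čech description of the local cohomology `H^2_m(R, W_lO)`. -/
def Nsub (p : ℕ) [Fact p.Prime] (f : PS k) (l : ℕ) : AddSubgroup (WittVector p (Lloc k f)) :=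
  AddSubgroup.closure
    (Set.range (WittVector.map (p := p) (phiX k f) :
        WittVector p (Localization.Away (xR k f)) → WittVector p (Lloc k f)) ∪
      Set.range (WittVector.map (p := p) (phiY k f) :
        WittVector p (Localization.Away (yR k f)) → WittVector p (Lloc k f)) ∪
      Set.range ((⇑(WittVector.verschiebung (p := p) (R := Lloc k f)))^[l]))

instance : Fact (Nat.Prime 2) := ⟨by norm_num⟩

/-- The defining equation of the rational double point of type `E_7^1` in characteristic `2`. -/
abbrev fE7p1 : PS k := X 2 ^ 2 + X 0 ^ 3 + X 0 * X 1 ^ 3 + X 0 ^ 2 * X 1 * X 2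

section RegularSequence

variable {R : Type*} [CommRing R] {x y z : R}

lemma pow_mul_cancel_of_regular (hx : ∀ a, x * a = 0 → a = 0) (n : ℕ) {a b : R}
    (h : x ^ n * a = x ^ n * b) : a = b := by
  induction n with
  | zero => simpa using h
  | succ n ih =>
    refine ih (sub_eq_zero.mp (hx _ ?_))
    linear_combination h

lemma pow_dvd_of_pow_dvd_pow_mul (hx : ∀ a, x * a = 0 → a = 0)
    (hxy : ∀ a, x ∣ y * a → x ∣ a) (n m : ℕ) {a : R} (h : x ^ n ∣ y ^ m * a) : x ^ n ∣ a := by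
  have key : ∀ (n : ℕ) (a : R), x ^ n ∣ y * a → x ^ n ∣ a := by
    intro n
    induction n with
    | zero => intro a _; simp
    | succ n ih =>
      rintro a ⟨b, hb⟩
      obtain ⟨c, rfl⟩ := hxy a ⟨x ^ n * b, by rw [hb]; ring⟩
      obtain ⟨d, rfl⟩ := ih c ⟨b, sub_eq_zero.mp (hx _ (by linear_combination hb))⟩
      exact ⟨d, by ring⟩
  induction m with
  | zero => simpa using h
  | succ m ih => exact ih (key n _ (by rwa [← mul_assoc, ← pow_succ']))

lemma dvd_of_dvd_mul_symm (hx : ∀ a, x * a = 0 → a = 0)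
    (hxy : ∀ a, x ∣ y * a → x ∣ a) (a : R) (h : y ∣ x * a) : y ∣ a := by
  obtain ⟨b, hb⟩ := h
  obtain ⟨c, rfl⟩ := hxy b ⟨a, hb.symm⟩
  exact ⟨c, sub_eq_zero.mp (hx _ (by linear_combination hb))⟩

lemma mul_pow_ne_of_regular (hx : ∀ a, x * a = 0 → a = 0) (hy : ∀ a, y * a = 0 → a = 0)
    (hxy : ∀ a, x ∣ y * a → x ∣ a) (hz : ∀ a b, z ≠ x * a + y * b) (n : ℕ) (a b : R) :
    z * (x * y) ^ n ≠ a * x ^ (n + 1) + b * y ^ (n + 1) := by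
  intro h
  have hyx := dvd_of_dvd_mul_symm hx hxy
  obtain ⟨d, hd⟩ : y ^ (n + 1) ∣ z * y ^ n - x * a :=
    pow_dvd_of_pow_dvd_pow_mul hy hyx (n + 1) n ⟨b, by
      rw [mul_pow] at h
      linear_combination h⟩
  obtain ⟨c, rfl⟩ : y ^ n ∣ a :=
    pow_dvd_of_pow_dvd_pow_mul hy hyx n 1 ⟨z - y * d, by linear_combination -hd⟩
  exact hz c d (pow_mul_cancel_of_regular hy n (by linear_combination hd))

end RegularSequence

section Cech

variable {R : Type*} [CommRing R] {x y z : R}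
  {A B L : Type*} [CommRing A] [CommRing B] [CommRing L]
  [Algebra R A] [Algebra R B] [Algebra R L]
  [IsLocalization.Away x A] [IsLocalization.Away y B]

lemma algebraMap_injective_of_regular [IsLocalization.Away (x * y) L]
    (hx : ∀ a, x * a = 0 → a = 0)
    (hy : ∀ a, y * a = 0 → a = 0) : Function.Injective (algebraMap R L) := by
  refine IsLocalization.injective (M := Submonoid.powers (x * y)) L ?_
  refine Submonoid.powers_le.mpr (mem_nonZeroDivisors_iff_right.mpr fun a ha => ?_)
  exact hy a (hx _ (by linear_combination ha))

variable (x) in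
lemma exists_mul_pow_eq_algebraMap (f : A →+* L) (hf : ∀ r, f (algebraMap R A r) = algebraMap R L r)
    (a : A) : ∃ (n : ℕ) (r : R), f a * algebraMap R L x ^ n = algebraMap R L r := by
  obtain ⟨⟨r, ⟨_, n, rfl⟩⟩, h⟩ := IsLocalization.surj (Submonoid.powers x) a
  refine ⟨n, r, ?_⟩
  have := congrArg f h
  simpa [hf] using this

variable (x y) in
lemma isUnit_algebraMap_left [IsLocalization.Away (x * y) L] : IsUnit (algebraMap R L x) :=
  isUnit_of_dvd_unit (by rw [map_mul]; exact dvd_mul_right _ _)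
    (IsLocalization.Away.algebraMap_isUnit (S := L) (x * y))

lemma injective_of_algebraMap_injective (x : R) [IsLocalization.Away x A]
    (hL : Function.Injective (algebraMap R L)) (f : A →+* L)
    (hf : ∀ r, f (algebraMap R A r) = algebraMap R L r) : Function.Injective f := by
  refine (injective_iff_map_eq_zero f).mpr fun a ha => ?_
  obtain ⟨⟨r, s⟩, h⟩ := IsLocalization.surj (Submonoid.powers x) a
  have h0 : algebraMap R L r = 0 := by rw [← hf, ← h, map_mul, ha, zero_mul]
  have hr : r = 0 := hL (by rw [h0, map_zero])
  rw [hr, map_zero] at h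
  exact ((IsLocalization.map_units A s).mul_left_eq_zero).mp h

variable (x y) in
lemma exists_algebraMap_of_add_eq_zero [IsLocalization.Away (x * y) L]
    (hx : ∀ a, x * a = 0 → a = 0)
    (hxy : ∀ a, x ∣ y * a → x ∣ a) (hL : Function.Injective (algebraMap R L))
    (f : A →+* L) (hf : ∀ r, f (algebraMap R A r) = algebraMap R L r)
    (g : B →+* L) (hg : ∀ r, g (algebraMap R B r) = algebraMap R L r)
    (a : A) (b : B) (h : f a + g b = 0) : ∃ r, f a = algebraMap R L r := by
  obtain ⟨n, r, hr⟩ := exists_mul_pow_eq_algebraMap x f hf a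
  obtain ⟨m, s, hs⟩ := exists_mul_pow_eq_algebraMap y g hg b
  obtain ⟨c, rfl⟩ : x ^ n ∣ r := pow_dvd_of_pow_dvd_pow_mul hx hxy n m ⟨-s, hL (by
    simp only [map_mul, map_pow, map_neg, ← hr, ← hs]
    linear_combination (algebraMap R L x) ^ n * (algebraMap R L y) ^ m * h)⟩
  refine ⟨c, ((isUnit_algebraMap_left x y).pow n).mul_right_cancel ?_⟩
  rw [hr, map_mul, map_pow, mul_comm]

variable (x y) in
lemma cech_add_ne (hx : ∀ a, x * a = 0 → a = 0) (hy : ∀ a, y * a = 0 → a = 0)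
    (hxy : ∀ a, x ∣ y * a → x ∣ a) (hz : ∀ a b, z ≠ x * a + y * b)
    (hL : Function.Injective (algebraMap R L))
    (f : A →+* L) (hf : ∀ r, f (algebraMap R A r) = algebraMap R L r)
    (g : B →+* L) (hg : ∀ r, g (algebraMap R B r) = algebraMap R L r)
    (w : L) (hw : w * (algebraMap R L x * algebraMap R L y) = algebraMap R L z)
    (a : A) (b : B) : w ≠ f a + g b := by
  intro h
  obtain ⟨n, r, hr⟩ := exists_mul_pow_eq_algebraMap x f hf a
  obtain ⟨m, s, hs⟩ := exists_mul_pow_eq_algebraMap y g hg b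
  refine mul_pow_ne_of_regular hx hy hxy hz (n + m) (s * y ^ (n + 1)) (r * x ^ (m + 1)) (hL ?_)
  simp only [map_mul, map_pow, map_add, ← hr, ← hs, ← hw, h]
  ring

end Cech

section Equation

variable {k}

lemma coeff_X_pow_mul_of_lt (i : Fin 3) (n : ℕ) (φ : PS k) (m : Fin 3 →₀ ℕ) (h : m i < n) :
    coeff m (X i ^ n * φ) = 0 :=
  X_pow_dvd_iff.mp (dvd_mul_right _ _) m h

lemma coeff_add_single_X_pow_mul (i : Fin 3) (n : ℕ) (φ : PS k) (m : Fin 3 →₀ ℕ) :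
    coeff (m + Finsupp.single i n) (X i ^ n * φ) = coeff m φ := by
  rw [X_pow_eq, add_comm, coeff_add_monomial_mul, one_mul]

lemma X_zero_dvd_of_dvd_fE7p1_mul {u : PS k} (h : X 0 ∣ fE7p1 k * u) : X 0 ∣ u := by
  rw [X_dvd_iff] at h ⊢
  intro m hm
  have h1 := h (m + Finsupp.single 2 2) (by simp [hm])
  have e : fE7p1 k * u = X 2 ^ 2 * u +
      X 0 ^ 1 * ((X 0 ^ 2 + X 1 ^ 3 + X 0 * X 1 * X 2) * u) := by ring
  rwa [e, map_add, coeff_add_single_X_pow_mul, coeff_X_pow_mul_of_lt _ _ _ _ (by simp [hm]),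
    add_zero] at h1

lemma X_one_dvd_of_dvd_fE7p1_mul {u : PS k} (h : X 1 ∣ fE7p1 k * u) : X 1 ∣ u := by
  rw [X_dvd_iff] at h ⊢
  suffices ∀ (n : ℕ) (m : Fin 3 →₀ ℕ), m 0 = n → m 1 = 0 → coeff m u = 0 from
    fun m hm => this _ m rfl hm
  intro n
  induction n using Nat.strong_induction_on with
  | _ n ih =>
    intro m hn hm
    have h1 := h (m + Finsupp.single 2 2) (by simp [hm])
    have e : fE7p1 k * u = X 2 ^ 2 * u + X 0 ^ 3 * u +
        X 1 ^ 1 * ((X 0 * X 1 ^ 2 + X 0 ^ 2 * X 2) * u) := by ring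
    rw [e, map_add, map_add, coeff_add_single_X_pow_mul,
      coeff_X_pow_mul_of_lt 1 _ _ _ (by simp [hm]), add_zero] at h1
    suffices coeff (m + Finsupp.single 2 2) (X 0 ^ 3 * u) = 0 by rwa [this, add_zero] at h1
    by_cases h3 : m 0 < 3
    · exact coeff_X_pow_mul_of_lt _ _ _ _ (by simpa using h3)
    · obtain ⟨m', rfl⟩ : ∃ m', m = m' + Finsupp.single 0 3 :=
        ⟨m - Finsupp.single 0 3, (tsub_add_cancel_of_le (by
          rw [Finsupp.single_le_iff]; omega)).symm⟩
      rw [add_right_comm, coeff_add_single_X_pow_mul]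
      refine ih _ ?_ _ rfl ?_
      · simp at hn ⊢; omega
      · simpa using hm

lemma eq_zero_of_mk_X_mul (i : Fin 3) (hi : ∀ u : PS k, X i ∣ fE7p1 k * u → X i ∣ u)
    (a : Rq k (fE7p1 k)) (h : Ideal.Quotient.mk _ (X i) * a = 0) : a = 0 := by
  obtain ⟨g, rfl⟩ := Ideal.Quotient.mk_surjective a
  rw [← map_mul, Ideal.Quotient.eq_zero_iff_mem, Ideal.mem_span_singleton] at h
  rw [Ideal.Quotient.eq_zero_iff_mem, Ideal.mem_span_singleton]
  obtain ⟨u, hu⟩ := h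
  obtain ⟨v, rfl⟩ := hi u ⟨g, hu.symm⟩
  refine ⟨v, mul_left_cancel₀ (a := (X i : PS k)) (fun h0 => ?_) ?_⟩
  · have := congrArg (coeff (Finsupp.single i 1)) h0
    rw [coeff_index_single_self_X] at this
    simp at this
  · rw [hu]; ring

lemma xR_dvd_of_dvd_yR_mul (a : Rq k (fE7p1 k)) (h : xR k (fE7p1 k) ∣ yR k (fE7p1 k) * a) :
    xR k (fE7p1 k) ∣ a := by
  obtain ⟨g, rfl⟩ := Ideal.Quotient.mk_surjective a
  obtain ⟨b, hb⟩ := h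
  obtain ⟨v, rfl⟩ := Ideal.Quotient.mk_surjective b
  rw [← map_mul, ← map_mul, Ideal.Quotient.eq, Ideal.mem_span_singleton] at hb
  obtain ⟨u, hu⟩ := hb
  let w : PS k := fun m => coeff (m + Finsupp.single 2 2) g
  have hw : X 0 ∣ g - X 2 ^ 2 * w := by
    rw [X_dvd_iff]
    intro m hm
    by_cases h2 : m 2 < 2
    · rw [map_sub, coeff_X_pow_mul_of_lt _ _ _ _ h2, sub_zero,
        ← coeff_add_single_X_pow_mul 1 1 g m]
      have e : X 1 ^ 1 * g = X 2 ^ 2 * u +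
          X 0 ^ 1 * (v + (X 0 ^ 2 + X 1 ^ 3 + X 0 * X 1 * X 2) * u) := by
        linear_combination hu
      rw [e, map_add, coeff_X_pow_mul_of_lt 2 _ _ _ (by simpa using h2),
        coeff_X_pow_mul_of_lt 0 _ _ _ (by simp [hm]), add_zero]
    · obtain ⟨m', rfl⟩ : ∃ m', m = m' + Finsupp.single 2 2 :=
        ⟨m - Finsupp.single 2 2, (tsub_add_cancel_of_le (by
          rw [Finsupp.single_le_iff]; omega)).symm⟩
      rw [map_sub, coeff_add_single_X_pow_mul]
      exact sub_self _
  obtain ⟨c, hc⟩ := hw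
  refine ⟨Ideal.Quotient.mk _ (c - (X 0 ^ 2 + X 1 ^ 3 + X 0 * X 1 * X 2) * w), ?_⟩
  rw [← map_mul, Ideal.Quotient.eq, Ideal.mem_span_singleton]
  exact ⟨w, by linear_combination hc⟩

lemma zR_ne (a b : Rq k (fE7p1 k)) :
    zR k (fE7p1 k) ≠ xR k (fE7p1 k) * a + yR k (fE7p1 k) * b := by
  intro h
  obtain ⟨a, rfl⟩ := Ideal.Quotient.mk_surjective a
  obtain ⟨b, rfl⟩ := Ideal.Quotient.mk_surjective b
  rw [← map_mul, ← map_mul, ← map_add, Ideal.Quotient.eq, Ideal.mem_span_singleton] at h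
  obtain ⟨u, hu⟩ := h
  have e : (X 2 : PS k) = X 0 ^ 1 * (a + (X 0 ^ 2 + X 1 ^ 3 + X 0 * X 1 * X 2) * u)
      + X 1 ^ 1 * b + X 2 ^ 2 * u := by
    linear_combination hu
  have := congrArg (coeff (Finsupp.single 2 1)) e
  rw [map_add, map_add, coeff_X_pow_mul_of_lt 0 _ _ _ (by simp),
    coeff_X_pow_mul_of_lt 1 _ _ _ (by simp), coeff_X_pow_mul_of_lt 2 _ _ _ (by simp),
    coeff_index_single_self_X] at this
  simp at this

end Equation

section Witt

open WittVector

lemma exists_teichmuller_add_of_regular_two {A : Type*} [CommRing A]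
    (h2 : ∀ a : A, 2 * a = 0 → a = 0) (a b : A) :
    ∃ c : WittVector 2 A, teichmuller 2 a + teichmuller 2 b =
      teichmuller 2 (a + b) + verschiebung (teichmuller 2 (-(a * b))) +
      verschiebung (verschiebung
        (teichmuller 2 (-(a ^ 3 * b) - 2 * (a ^ 2 * b ^ 2) - a * b ^ 3))) +
      verschiebung (verschiebung (verschiebung c)) := by
  set d := teichmuller 2 a + teichmuller 2 b - (teichmuller 2 (a + b) +
    verschiebung (teichmuller 2 (-(a * b))) + verschiebung (verschiebung
        (teichmuller 2 (-(a ^ 3 * b) - 2 * (a ^ 2 * b ^ 2) - a * b ^ 3)))) with hd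
  have g0 : ghostComponent 0 d = 0 := by
    simp [hd, ghostComponent_teichmuller, ghostComponent_zero_verschiebung]
  have g1 : ghostComponent 1 d = 0 := by
    simp only [hd, map_sub, map_add, ghostComponent_teichmuller, ghostComponent_verschiebung,
      ghostComponent_zero_verschiebung]
    push_cast
    ring
  have g2 : ghostComponent 2 d = 0 := by
    simp only [hd, map_sub, map_add, ghostComponent_teichmuller, ghostComponent_verschiebung]
    push_cast
    ring
  have c0 : d.coeff 0 = 0 := by
    simpa [ghostComponent_apply, wittPolynomial_zero] using g0
  have c1 : d.coeff 1 = 0 := by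
    refine h2 _ ?_
    simpa [ghostComponent_apply, wittPolynomial_one, c0] using g1
  have c2 : d.coeff 2 = 0 := by
    refine h2 _ (h2 _ ?_)
    have := g2
    simp [ghostComponent_apply, aeval_wittPolynomial, Finset.sum_range_succ, c0, c1] at this
    linear_combination this
  have h := eq_iterate_verschiebung (x := d) (n := 3) (by
    intro i hi
    interval_cases i <;> assumption)
  exact ⟨d.shift 3, by
    simp only [Function.iterate_succ, Function.iterate_zero, Function.comp, id] at h
    rw [← h, hd]; ring⟩

lemma exists_teichmuller_add {A : Type*} [CommRing A] (a b : A) :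
    ∃ c : WittVector 2 A, teichmuller 2 a + teichmuller 2 b =
      teichmuller 2 (a + b) + verschiebung (teichmuller 2 (-(a * b))) +
      verschiebung (verschiebung
        (teichmuller 2 (-(a ^ 3 * b) - 2 * (a ^ 2 * b ^ 2) - a * b ^ 3))) +
      verschiebung (verschiebung (verschiebung c)) := by
  obtain ⟨c, hc⟩ := exists_teichmuller_add_of_regular_two (A := MvPolynomial (Fin 2) ℤ)
    (fun a ha => by simpa using ha) (MvPolynomial.X 0) (MvPolynomial.X 1)
  let φ : MvPolynomial (Fin 2) ℤ →+* A := MvPolynomial.eval₂Hom (Int.castRingHom A) ![a, b]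
  refine ⟨WittVector.map φ c, ?_⟩
  have := congrArg (WittVector.map φ) hc
  simpa [φ, map_verschiebung, map_teichmuller] using this

lemma frobeniusFun_teichmuller_two {A : Type*} [CommRing A] [CharP A 2] (a : A) :
    frobeniusFun (teichmuller 2 a) = teichmuller 2 (a ^ 2) := by
  have h := frobenius_eq_map_frobenius (p := 2) (R := A)
  have := congrArg (fun f => f (teichmuller 2 a)) h
  change frobenius (teichmuller 2 a) = _
  simpa [map_teichmuller, frobenius_def] using this

end Witt

section Nsub

open WittVector

lemma iterate_verschiebung_add {A : Type*} [CommRing A] (l : ℕ) (a b : WittVector 2 A) :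
    (⇑(verschiebung (p := 2) (R := A)))^[l] (a + b) = verschiebung^[l] a + verschiebung^[l] b := by
  induction l generalizing a b with
  | zero => rfl
  | succ l ih => simp

lemma iterate_verschiebung_neg {A : Type*} [CommRing A] (l : ℕ) (a : WittVector 2 A) :
    (⇑(verschiebung (p := 2) (R := A)))^[l] (-a) = -verschiebung^[l] a := by
  induction l generalizing a with
  | zero => rfl
  | succ l ih => simp

lemma exists_of_mem_Nsub {f : PS k} {l : ℕ} {w : WittVector 2 (Lloc k f)}
    (h : w ∈ Nsub k 2 f l) : ∃ a b c, w = WittVector.map (phiX k f) a +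
      WittVector.map (phiY k f) b + verschiebung^[l] c := by
  have hz : (⇑(verschiebung (p := 2) (R := Lloc k f)))^[l] 0 = 0 := by
    simp
  induction h using AddSubgroup.closure_induction with
  | mem w hw =>
    rcases hw with (⟨a, rfl⟩ | ⟨b, rfl⟩) | ⟨c, rfl⟩
    · exact ⟨a, 0, 0, by simp [hz]⟩
    · exact ⟨0, b, 0, by simp [hz]⟩
    · exact ⟨0, 0, c, by simp⟩
  | zero => exact ⟨0, 0, 0, by simp [hz]⟩
  | add v w _ _ hv hw =>
    obtain ⟨a, b, c, rfl⟩ := hv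
    obtain ⟨a', b', c', rfl⟩ := hw
    exact ⟨a + a', b + b', c + c', by rw [iterate_verschiebung_add, map_add, map_add]; abel⟩
  | neg v _ hv =>
    obtain ⟨a, b, c, rfl⟩ := hv
    exact ⟨-a, -b, -c, by rw [iterate_verschiebung_neg, map_neg, map_neg]; abel⟩

variable {k}

lemma phiX_algebraMap (f : PS k) (r : Rq k f) :
    phiX k f (algebraMap _ _ r) = algebraMap _ _ r :=
  IsLocalization.Away.awayToAwayRight_eq _ _ r

lemma phiY_algebraMap (f : PS k) (r : Rq k f) :
    phiY k f (algebraMap _ _ r) = algebraMap _ _ r :=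
  IsLocalization.Away.awayToAwayLeft_eq _ _ r

lemma eq_zero_of_xR_mul (a : Rq k (fE7p1 k)) (h : xR k (fE7p1 k) * a = 0) : a = 0 :=
  eq_zero_of_mk_X_mul 0 (fun _ => X_zero_dvd_of_dvd_fE7p1_mul) a h

lemma eq_zero_of_yR_mul (a : Rq k (fE7p1 k)) (h : yR k (fE7p1 k) * a = 0) : a = 0 :=
  eq_zero_of_mk_X_mul 1 (fun _ => X_one_dvd_of_dvd_fE7p1_mul) a h

lemma algebraMap_Lloc_injective :
    Function.Injective (algebraMap (Rq k (fE7p1 k)) (Lloc k (fE7p1 k))) :=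
  algebraMap_injective_of_regular eq_zero_of_xR_mul eq_zero_of_yR_mul

lemma phiX_injective : Function.Injective (phiX k (fE7p1 k)) :=
  injective_of_algebraMap_injective (xR k (fE7p1 k)) algebraMap_Lloc_injective _
    (phiX_algebraMap _)

lemma phiY_injective : Function.Injective (phiY k (fE7p1 k)) :=
  injective_of_algebraMap_injective (yR k (fE7p1 k)) algebraMap_Lloc_injective _
    (phiY_algebraMap _)

lemma exists_eq_add_of_verschiebung_eq_add {l : ℕ} {w : WittVector 2 (Lloc k (fE7p1 k))}
    {a b c} (h : verschiebung w = WittVector.map (phiX k (fE7p1 k)) a +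
      WittVector.map (phiY k (fE7p1 k)) b + verschiebung^[l + 1] c) :
    ∃ a b, w = WittVector.map (phiX k (fE7p1 k)) a + WittVector.map (phiY k (fE7p1 k)) b +
      verschiebung^[l] c := by
  have h0 : phiX k (fE7p1 k) (a.coeff 0) + phiY k (fE7p1 k) (b.coeff 0) = 0 := by
    have := congrArg WittVector.constantCoeff h
    rw [Function.iterate_succ_apply', map_add, map_add] at this
    simpa [WittVector.constantCoeff_apply] using this.symm
  obtain ⟨r, hr⟩ := exists_algebraMap_of_add_eq_zero (xR k (fE7p1 k)) (yR k (fE7p1 k))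
    eq_zero_of_xR_mul xR_dvd_of_dvd_yR_mul algebraMap_Lloc_injective
    _ (phiX_algebraMap _) _ (phiY_algebraMap _) _ _ h0
  have ha : a.coeff 0 = algebraMap _ _ r := phiX_injective (by rw [hr, phiX_algebraMap])
  have hb : b.coeff 0 = -algebraMap _ _ r := phiY_injective (by
    rw [map_neg, phiY_algebraMap, ← hr]; linear_combination h0)
  have hV : ∀ {A : Type} [CommRing A] (s : WittVector 2 A), WittVector.constantCoeff s = 0 →
      ∃ t, s = verschiebung t := fun s hs =>
    ⟨s.shift 1, eq_iterate_verschiebung (n := 1) (by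
      intro i hi
      interval_cases i
      exact hs)⟩
  obtain ⟨a', ha'⟩ := hV (a - teichmuller 2 (algebraMap _ _ r)) (by
    rw [map_sub, WittVector.constantCoeff_apply, WittVector.constantCoeff_apply, teichmuller_coeff_zero, ha, sub_self])
  obtain ⟨b', hb'⟩ := hV (b + teichmuller 2 (algebraMap _ _ r)) (by
    rw [map_add, WittVector.constantCoeff_apply, WittVector.constantCoeff_apply, teichmuller_coeff_zero, hb,
      neg_add_cancel])
  refine ⟨a', b', verschiebung_injective 2 _ ?_⟩
  have e1 := congrArg (WittVector.map (phiX k (fE7p1 k))) ha'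
  have e2 := congrArg (WittVector.map (phiY k (fE7p1 k))) hb'
  rw [map_sub, map_teichmuller, phiX_algebraMap] at e1
  rw [map_add, map_teichmuller, phiY_algebraMap] at e2
  rw [map_add, map_add, ← map_verschiebung, ← map_verschiebung, ← e1, ← e2, h,
    Function.iterate_succ_apply']
  ring

lemma zxy_mul (f : PS k) : zxy k f * (algebraMap _ _ (xR k f) * algebraMap _ _ (yR k f)) =
    algebraMap _ _ (zR k f) := by
  have h : zxy k f = IsLocalization.mk' (Lloc k f) (zR k f)
      (⟨xR k f * yR k f, Submonoid.mem_powers _⟩ : Submonoid.powers (xR k f * yR k f)) :=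
    Localization.mk_eq_mk'_apply _ _
  rw [h]
  refine (congrArg _ (map_mul _ _ _).symm).trans ?_
  exact IsLocalization.mk'_spec (Lloc k f) (zR k f)
    (⟨xR k f * yR k f, Submonoid.mem_powers _⟩ : Submonoid.powers (xR k f * yR k f))

lemma zxy_ne_add (a b) : zxy k (fE7p1 k) ≠ phiX k (fE7p1 k) a + phiY k (fE7p1 k) b :=
  cech_add_ne (xR k (fE7p1 k)) (yR k (fE7p1 k)) eq_zero_of_xR_mul eq_zero_of_yR_mul
    xR_dvd_of_dvd_yR_mul zR_ne algebraMap_Lloc_injective _ (phiX_algebraMap _) _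
    (phiY_algebraMap _) _ (zxy_mul _) a b

lemma teichmuller_zxy_ne_add {l : ℕ} (a b c) : teichmuller 2 (zxy k (fE7p1 k)) ≠
    WittVector.map (phiX k (fE7p1 k)) a + WittVector.map (phiY k (fE7p1 k)) b +
      verschiebung^[l + 1] c := by
  intro h
  have := congrArg WittVector.constantCoeff h
  rw [Function.iterate_succ_apply', map_add, map_add] at this
  exact zxy_ne_add (a.coeff 0) (b.coeff 0) (by simpa [WittVector.constantCoeff_apply] using this)

variable {f : PS k}

lemma map_phiX_mem (l : ℕ) (a) : WittVector.map (phiX k f) a ∈ Nsub k 2 f l :=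
  AddSubgroup.subset_closure (Or.inl (Or.inl ⟨a, rfl⟩))

lemma map_phiY_mem (l : ℕ) (b) : WittVector.map (phiY k f) b ∈ Nsub k 2 f l :=
  AddSubgroup.subset_closure (Or.inl (Or.inr ⟨b, rfl⟩))

lemma verschiebung_three_mem (c : WittVector 2 (Lloc k f)) :
    verschiebung (verschiebung (verschiebung c)) ∈ Nsub k 2 f 3 :=
  AddSubgroup.subset_closure (Or.inr ⟨c, rfl⟩)

lemma verschiebung_two_add_mem (a b : Lloc k f) :
    verschiebung (verschiebung (teichmuller 2 a)) + verschiebung (verschiebung (teichmuller 2 b)) -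
      verschiebung (verschiebung (teichmuller 2 (a + b))) ∈ Nsub k 2 f 3 := by
  obtain ⟨c, hc⟩ := exists_teichmuller_add a b
  rw [← map_add, ← map_add, ← map_sub, ← map_sub, hc, add_assoc, add_assoc, add_sub_cancel_left,
    ← map_add, ← map_add]
  exact verschiebung_three_mem _

lemma frobeniusFun_add_verschiebung_mem [CharP k 2] :
    frobeniusFun (teichmuller 2 (zxy k (fE7p1 k))) +
        verschiebung (verschiebung (teichmuller 2 (zxy k (fE7p1 k))))
      ∈ Nsub k 2 (fE7p1 k) 3 := by
  set N := Nsub k 2 (fE7p1 k) 3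
  have h2 : (2 : Lloc k (fE7p1 k)) = 0 := by
    have := congrArg ((algebraMap (Rq k (fE7p1 k)) (Lloc k (fE7p1 k))).comp
      ((Ideal.Quotient.mk (Ideal.span {fE7p1 k})).comp C)) (CharTwo.two_eq_zero (R := k))
    rwa [map_zero, map_ofNat] at this
  have : Nontrivial (Lloc k (fE7p1 k)) := ⟨_, _, zxy_ne_add 0 0⟩
  have : CharP (Lloc k (fE7p1 k)) 2 := CharTwo.of_one_ne_zero_of_two_eq_zero one_ne_zero h2
  rw [frobeniusFun_teichmuller_two]
  obtain ⟨x, hx⟩ : ∃ x, x = algebraMap _ (Lloc k (fE7p1 k)) (xR k (fE7p1 k)) := ⟨_, rfl⟩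
  obtain ⟨y, hy⟩ : ∃ y, y = algebraMap _ (Lloc k (fE7p1 k)) (yR k (fE7p1 k)) := ⟨_, rfl⟩
  obtain ⟨z, hz⟩ : ∃ z, z = algebraMap _ (Lloc k (fE7p1 k)) (zR k (fE7p1 k)) := ⟨_, rfl⟩
  have hw := zxy_mul (fE7p1 k)
  rw [← hx, ← hy, ← hz] at hw
  have hf : z ^ 2 + x ^ 3 + x * y ^ 3 + x ^ 2 * y * z = 0 := by
    rw [hx, hy, hz]
    simp only [← map_pow, ← map_mul, ← map_add]
    rw [Ideal.Quotient.eq_zero_iff_mem.mpr (Ideal.mem_span_singleton_self _), map_zero]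
  obtain ⟨i, hi⟩ : ∃ i, i = phiX k (fE7p1 k) (IsLocalization.Away.invSelf (xR k (fE7p1 k))) :=
    ⟨_, rfl⟩
  obtain ⟨j, hj⟩ : ∃ j, j = phiY k (fE7p1 k) (IsLocalization.Away.invSelf (yR k (fE7p1 k))) :=
    ⟨_, rfl⟩
  have hxi : x * i = 1 := by
    rw [hx, hi, ← phiX_algebraMap, ← map_mul, IsLocalization.Away.mul_invSelf, map_one]
  have hyj : y * j = 1 := by
    rw [hy, hj, ← phiY_algebraMap, ← map_mul, IsLocalization.Away.mul_invSelf, map_one]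
  have hX : x ∈ (phiX k (fE7p1 k)).range ∧ y ∈ (phiX k (fE7p1 k)).range ∧
      z ∈ (phiX k (fE7p1 k)).range ∧ i ∈ (phiX k (fE7p1 k)).range :=
    ⟨⟨_, (phiX_algebraMap _ _).trans hx.symm⟩, ⟨_, (phiX_algebraMap _ _).trans hy.symm⟩,
      ⟨_, (phiX_algebraMap _ _).trans hz.symm⟩, ⟨_, hi.symm⟩⟩
  have hY : x ∈ (phiY k (fE7p1 k)).range ∧ y ∈ (phiY k (fE7p1 k)).range ∧
      z ∈ (phiY k (fE7p1 k)).range ∧ j ∈ (phiY k (fE7p1 k)).range :=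
    ⟨⟨_, (phiY_algebraMap _ _).trans hx.symm⟩, ⟨_, (phiY_algebraMap _ _).trans hy.symm⟩,
      ⟨_, (phiY_algebraMap _ _).trans hz.symm⟩, ⟨_, hj.symm⟩⟩
  obtain ⟨hXx, hXy, hXz, hXi⟩ := hX
  obtain ⟨hYx, hYy, hYz, hYj⟩ := hY
  have tX : ∀ s ∈ (phiX k (fE7p1 k)).range, teichmuller 2 s ∈ N ∧
      verschiebung (teichmuller 2 s) ∈ N ∧ verschiebung (verschiebung (teichmuller 2 s)) ∈ N := by
    rintro _ ⟨s, rfl⟩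
    simp only [← map_teichmuller, ← map_verschiebung]
    exact ⟨map_phiX_mem _ _, map_phiX_mem _ _, map_phiX_mem _ _⟩
  have tY : ∀ s ∈ (phiY k (fE7p1 k)).range, teichmuller 2 s ∈ N ∧
      verschiebung (teichmuller 2 s) ∈ N ∧ verschiebung (verschiebung (teichmuller 2 s)) ∈ N := by
    rintro _ ⟨s, rfl⟩
    simp only [← map_teichmuller, ← map_verschiebung]
    exact ⟨map_phiY_mem _ _, map_phiY_mem _ _, map_phiY_mem _ _⟩
  set w := zxy k (fE7p1 k)
  have hw' : w = z * i * j := by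
    linear_combination i * j * hw - w * y * j * hxi - w * hyj
  obtain ⟨c₁, hc₁⟩ := exists_teichmuller_add (x * j ^ 2 + z * j) (y * i)
  obtain ⟨c₂, hc₂⟩ := exists_teichmuller_add j (z * i)
  have e₀ : x * j ^ 2 + z * j + y * i = w ^ 2 := by
    rw [hw']
    linear_combination (x * j ^ 2 + z * j + y * i) * h2 - i ^ 2 * j ^ 2 * hf +
      x * j ^ 2 * (x * i + 1) * hxi + y * i * (x * i * (y * j + 1) * hyj + hxi) +
      z * j * (y * j * (x * i + 1) * hxi + hyj)
  have e₁ : -((x * j ^ 2 + z * j) * (y * i)) = j + z * i := by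
    linear_combination -j * (x * i * hyj + hxi) - z * i * hyj - (j + z * i) * h2
  have e₂ : -(j * (z * i)) = w := by
    rw [hw']; linear_combination -(z * i * j) * h2
  obtain ⟨q₁, hq₁⟩ : ∃ q, q = j * (x ^ 2 * j ^ 4 + z ^ 2 * j ^ 2) + z * x * j ^ 4 +
    z * j ^ 2 * (x ^ 2 + y ^ 3 + x * y * z) := ⟨_, rfl⟩
  obtain ⟨q₂, hq₂⟩ : ∃ q, q = y * i ^ 2 + z * y ^ 2 * i ^ 3 := ⟨_, rfl⟩
  have e₃ : -((x * j ^ 2 + z * j) ^ 3 * (y * i)) -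
      2 * ((x * j ^ 2 + z * j) ^ 2 * (y * i) ^ 2) - (x * j ^ 2 + z * j) * (y * i) ^ 3 =
      q₁ + q₂ := by
    rw [hq₁, hq₂]
    linear_combination ((x * j ^ 2 + z * j) ^ 2 + (y * i) ^ 2) * e₁ +
      (-((x * j ^ 2 + z * j) ^ 2 * (y * i) ^ 2) + (j + z * i) * (x * z * j ^ 3)) * h2 +
      y * i ^ 2 * hyj + z * x * j ^ 4 * hxi + z * i * j ^ 2 * hf -
      z * j ^ 2 * (x ^ 2 + y ^ 3 + x * y * z) * hxi -
      z * j ^ 2 * (x ^ 2 + y ^ 3 + x * y * z) * h2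
  rw [e₀, e₁, e₃] at hc₁
  rw [e₂] at hc₂
  replace hc₂ := congrArg verschiebung hc₂
  simp only [map_add] at hc₂
  generalize teichmuller 2 (-(j ^ 3 * (z * i)) - 2 * (j ^ 2 * (z * i) ^ 2) -
    j * (z * i) ^ 3) = c₃ at hc₂
  have hww := verschiebung_two_add_mem w w
  rw [CharTwo.add_self_eq_zero w, teichmuller_zero, map_zero, map_zero, sub_zero] at hww
  have hqq := verschiebung_two_add_mem q₁ q₂
  have hq₁Y : q₁ ∈ (phiY k (fE7p1 k)).range := by
    obtain ⟨x', rfl⟩ := hYx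
    obtain ⟨y', rfl⟩ := hYy
    obtain ⟨z', rfl⟩ := hYz
    obtain ⟨j', rfl⟩ := hYj
    rw [hq₁]
    simp only [← map_pow, ← map_mul, ← map_add]
    exact ⟨_, rfl⟩
  have hq₂X : q₂ ∈ (phiX k (fE7p1 k)).range := by
    rw [hq₂]
    exact add_mem (mul_mem hXy (pow_mem hXi _)) (mul_mem (mul_mem hXz (pow_mem hXy _))
      (pow_mem hXi _))
  have hu : x * j ^ 2 + z * j ∈ (phiY k (fE7p1 k)).range :=
    add_mem (mul_mem hYx (pow_mem hYj _)) (mul_mem hYz hYj)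
  have hsum := N.add_mem (N.add_mem (N.add_mem (N.sub_mem
    (N.sub_mem (N.sub_mem (N.add_mem (tY _ hu).1 (tX _ (mul_mem hXy hXi)).1)
    (tY _ hYj).2.1) (tX _ (mul_mem hXz hXi)).2.1)
    (N.add_mem (tY _ hq₁Y).2.2 (tX _ hq₂X).2.2)) hqq) hww) (N.sub_mem
    (N.add_mem (verschiebung_three_mem c₃) (verschiebung_three_mem (verschiebung c₂)))
    (verschiebung_three_mem c₁))
  convert hsum using 1
  linear_combination -hc₁ + hc₂

end Nsub

/-- For the rational double point of type `E_7^1` in characteristic `2`,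
with `τ` the Teichmüller lift of `z/(xy)` in `𝕎L`: `F(τ) + V²(τ) ∈ N₃`, `τ ∉ N₃`,
`V(τ) ∉ N₃` and `V²(τ) ∉ N₃`; i.e. the class of the length-3 Teichmüller lift of `z/(xy)`
in `H^2_m(R, W₃O)` satisfies `(F + V²)(class) = 0` and is not annihilated by `V` or `V²`.
This realizes the relations `(F+V²) ≡ V³ ≡ 0` on the generator `f₁⁽³⁾` of the Dieudonné
module of `E_7^1` in characteristic 2, which has length 3
(corresponding to `Picloc^{loc,loc} ≅ L_{2,3}[V + F²]`). -/
theorem wittLocalCohomology_E7p1_char2 (k : Type) [Field k] [IsAlgClosed k] [CharP k 2] :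
    -- (i) F(τ) + V²(τ) ∈ N₃
    WittVector.frobeniusFun (WittVector.teichmuller 2 (zxy k (fE7p1 k))) +
        WittVector.verschiebung
          (WittVector.verschiebung (WittVector.teichmuller 2 (zxy k (fE7p1 k))))
      ∈ Nsub k 2 (fE7p1 k) 3 ∧
    -- (ii) τ ∉ N₃
    WittVector.teichmuller 2 (zxy k (fE7p1 k)) ∉ Nsub k 2 (fE7p1 k) 3 ∧
    -- (iii) V(τ) ∉ N₃
    WittVector.verschiebung (WittVector.teichmuller 2 (zxy k (fE7p1 k)))
      ∉ Nsub k 2 (fE7p1 k) 3 ∧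
    -- (iv) V²(τ) ∉ N₃
    WittVector.verschiebung (WittVector.verschiebung (WittVector.teichmuller 2 (zxy k (fE7p1 k))))
      ∉ Nsub k 2 (fE7p1 k) 3 := by
  refine ⟨frobeniusFun_add_verschiebung_mem, fun h => ?_, fun h => ?_, fun h => ?_⟩
  · obtain ⟨a, b, c, h⟩ := exists_of_mem_Nsub k h
    exact teichmuller_zxy_ne_add a b c h
  · obtain ⟨a, b, c, h⟩ := exists_of_mem_Nsub k h
    obtain ⟨a, b, h⟩ := exists_eq_add_of_verschiebung_eq_add h
    exact teichmuller_zxy_ne_add a b c h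
  · obtain ⟨a, b, c, h⟩ := exists_of_mem_Nsub k h
    obtain ⟨a, b, h⟩ := exists_eq_add_of_verschiebung_eq_add h
    obtain ⟨a, b, h⟩ := exists_eq_add_of_verschiebung_eq_add h
    exact teichmuller_zxy_ne_add a b c h
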